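/- Let ρ be a normalized state on registers A, B, let ω_A be positive semidefinite on A, let σ_B be positive semidefinite on B, and let α ∈ (0,1)∪(1,∞); assume supp(ρ_AB) ⊆ supp(ω_A⊗σ_B) (so all divergences below are finite). Define η_A = (ρ_A^{1/2}ω_A^{(1−α)/α}ρ_A^{1/2})^α / Tr[(ρ_A^{1/2}ω_A^{(1−α)/α}ρ_A^{1/2})^α] and η_AB = η_A^{1/2}·ρ_{B|A}·η_A^{1/2}. Then the exact identity D_α(ρ_AB‖ω_A⊗σ_B) = D_α(ρ_A‖ω_A) + D_α(η_AB‖η_A⊗σ_B) holds. In particular, taking ω_A = 𝟙_A (so η_A = ρ_A^α/Tr[ρ_A^α]), one has H_α↑(A|B)_ρ = H_α(A)_ρ − I_α↓(A;B)_η, where H_α(A)_ρ = −D_α(ρ_A‖𝟙_A). -/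

import Mathlib

open scoped Kronecker
open Matrix
open scoped ComplexOrder

noncomputable section
namespace QITLeak

variable {A B : Type*}

/-- Real matrix power via spectral decomposition (Moore–Penrose pseudoinverse powers,
since `(0:ℝ) ^ (p:ℝ) = 0` for `p ≠ 0`). Junk value `0` on non-Hermitian input. -/
noncomputable def mpow [Fintype A] [DecidableEq A] (ρ : Matrix A A ℂ) (p : ℝ) :
    Matrix A A ℂ :=
  if hρ : ρ.IsHermitian then
    (hρ.eigenvectorUnitary : Matrix A A ℂ) *
      Matrix.diagonal (fun i => ((hρ.eigenvalues i ^ p : ℝ) : ℂ)) *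
      (star (hρ.eigenvectorUnitary : Matrix A A ℂ))
  else 0

/-- A normalized state (density matrix). -/
def IsState [Fintype A] (ρ : Matrix A A ℂ) : Prop := ρ.PosSemidef ∧ ρ.trace = 1

/-- A subnormalized state. -/
def IsSubState [Fintype A] (ρ : Matrix A A ℂ) : Prop := ρ.PosSemidef ∧ (ρ.trace).re ≤ 1

/-- Partial trace over the second tensor factor. -/
def ptB [Fintype B] (ρ : Matrix (A × B) (A × B) ℂ) : Matrix A A ℂ :=
  Matrix.of fun a a' => ∑ b, ρ (a, b) (a', b)

/-- Partial trace over the first tensor factor. -/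
def ptA [Fintype A] (ρ : Matrix (A × B) (A × B) ℂ) : Matrix B B ℂ :=
  Matrix.of fun b b' => ∑ a, ρ (a, b) (a, b')

/-- Partial trace over the factor `B`, along a decomposition `X ≃ A × B` of the registers. -/
def traceOut {X A B : Type*} [Fintype B] (e : X ≃ A × B) (ρ : Matrix X X ℂ) :
    Matrix A A ℂ :=
  Matrix.of fun a a' => ∑ b, ρ (e.symm (a, b)) (e.symm (a', b))

/-- Support inclusion `supp ρ ⊆ supp σ` (for PSD matrices: kernel inclusion). -/
def suppSubset [Fintype A] (ρ σ : Matrix A A ℂ) : Prop :=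
  ∀ v : A → ℂ, σ *ᵥ v = 0 → ρ *ᵥ v = 0

/-- The real-valued core formula of the sandwiched Rényi divergence (base 2). -/
def DR (α : ℝ) [Fintype A] [DecidableEq A] (ρ σ : Matrix A A ℂ) : ℝ :=
  (α - 1)⁻¹ * Real.logb 2
    (((mpow (mpow σ ((1 - α) / (2 * α)) * ρ * mpow σ ((1 - α) / (2 * α))) α).trace.re)
      / (ρ.trace).re)

open scoped Classical in
/-- The sandwiched Rényi divergence `D_α(ρ‖σ)`, with value `⊤` outside the
support/orthogonality conditions. -/
def D (α : ℝ) [Fintype A] [DecidableEq A] (ρ σ : Matrix A A ℂ) : EReal :=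
  if (α < 1 ∧ ¬ (ρ * σ = 0 ∧ σ * ρ = 0)) ∨ suppSubset ρ σ then ((DR α ρ σ : ℝ) : EReal)
  else ⊤

/-- The max-divergence `D_∞(ρ‖σ)`: log of the least `μ ≥ 0` with `ρ ≤ μσ` (`⊤` if none). -/
def Dmax [Fintype A] (ρ σ : Matrix A A ℂ) : EReal :=
  sInf {x : EReal | ∃ μ : ℝ, 0 ≤ μ ∧ (μ • σ - ρ).PosSemidef ∧ x = ((Real.logb 2 μ : ℝ) : EReal)}

section Ent
variable [Fintype A] [DecidableEq A] [Fintype B] [DecidableEq B]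

/-- `H_α↑(A|B)_ρ` for `ρ` on `A × B`. -/
def HUp (α : ℝ) (ρ : Matrix (A × B) (A × B) ℂ) : EReal :=
  - sInf {x : EReal | ∃ σ : Matrix B B ℂ, IsState σ ∧ x = D α ρ ((1 : Matrix A A ℂ) ⊗ₖ σ)}

/-- `H_α(A|B)_ρ` for `ρ` on `A × B`. -/
def Hdn (α : ℝ) (ρ : Matrix (A × B) (A × B) ℂ) : EReal :=
  - D α ρ ((1 : Matrix A A ℂ) ⊗ₖ ptA ρ)

/-- `I_α↓(A;B)_ρ` for `ρ` on `A × B`. -/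
def Idown (α : ℝ) (ρ : Matrix (A × B) (A × B) ℂ) : EReal :=
  sInf {x : EReal | ∃ σ : Matrix B B ℂ, IsState σ ∧ x = D α ρ ((ptB ρ) ⊗ₖ σ)}

/-- `I_α(A:B)_ρ` for `ρ` on `A × B`. -/
def Imut (α : ℝ) (ρ : Matrix (A × B) (A × B) ℂ) : EReal :=
  D α ρ ((ptB ρ) ⊗ₖ (ptA ρ))

/-- `I_α↓↓(A:B)_ρ` for `ρ` on `A × B`. -/
def Idd (α : ℝ) (ρ : Matrix (A × B) (A × B) ℂ) : EReal :=
  sInf {x : EReal | ∃ (ω : Matrix A A ℂ) (σ : Matrix B B ℂ),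
    IsState ω ∧ IsState σ ∧ x = D α ρ (ω ⊗ₖ σ)}

/-- `H_min↑(A|B)_ρ = H_∞↑(A|B)_ρ`. -/
def HminUp (ρ : Matrix (A × B) (A × B) ℂ) : EReal :=
  - sInf {x : EReal | ∃ σ : Matrix B B ℂ, IsState σ ∧ x = Dmax ρ ((1 : Matrix A A ℂ) ⊗ₖ σ)}

/-- `I_∞↓(A;B)_ρ`. -/
def ImaxD (ρ : Matrix (A × B) (A × B) ℂ) : EReal :=
  sInf {x : EReal | ∃ σ : Matrix B B ℂ, IsState σ ∧ x = Dmax ρ ((ptB ρ) ⊗ₖ σ)}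

/-- `I_∞(A:B)_ρ` (unoptimized max-information). -/
def ImaxND (ρ : Matrix (A × B) (A × B) ℂ) : EReal :=
  Dmax ρ ((ptB ρ) ⊗ₖ (ptA ρ))

/-- `I_∞↓↓(A:B)_ρ`. -/
def IddMax (ρ : Matrix (A × B) (A × B) ℂ) : EReal :=
  sInf {x : EReal | ∃ (ω : Matrix A A ℂ) (σ : Matrix B B ℂ),
    IsState ω ∧ IsState σ ∧ x = Dmax ρ (ω ⊗ₖ σ)}

end Ent

/-- Trace norm. -/
def traceNorm [Fintype A] [DecidableEq A] (M : Matrix A A ℂ) : ℝ :=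
  (mpow (Mᴴ * M) (1 / 2 : ℝ)).trace.re

/-- Generalized fidelity of subnormalized states. -/
def gFid [Fintype A] [DecidableEq A] (ρ σ : Matrix A A ℂ) : ℝ :=
  traceNorm (mpow ρ (1 / 2 : ℝ) * mpow σ (1 / 2 : ℝ)) +
    Real.sqrt ((1 - ρ.trace.re) * (1 - σ.trace.re))

/-- Purified distance. -/
def pDist [Fintype A] [DecidableEq A] (ρ σ : Matrix A A ℂ) : ℝ :=
  Real.sqrt (1 - gFid ρ σ ^ 2)

section Smooth
variable [Fintype A] [DecidableEq A] [Fintype B] [DecidableEq B]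

/-- Smoothed min-entropy `H_min↑,ε(A|B)_ρ`. -/
def HminUpEps (ε : ℝ) (ρ : Matrix (A × B) (A × B) ℂ) : EReal :=
  sSup {x : EReal | ∃ ρ' : Matrix (A × B) (A × B) ℂ,
    IsSubState ρ' ∧ pDist ρ' ρ ≤ ε ∧ x = HminUp ρ'}

/-- Smoothed max-information `I_max↓,ε(A;B)_ρ`. -/
def ImaxDEps (ε : ℝ) (ρ : Matrix (A × B) (A × B) ℂ) : EReal :=
  sInf {x : EReal | ∃ ρ' : Matrix (A × B) (A × B) ℂ,
    IsSubState ρ' ∧ pDist ρ' ρ ≤ ε ∧ x = ImaxD ρ'}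

/-- Smoothed (unoptimized) max-information `I_max^ε(A:B)_ρ`. -/
def ImaxNDEps (ε : ℝ) (ρ : Matrix (A × B) (A × B) ℂ) : EReal :=
  sInf {x : EReal | ∃ ρ' : Matrix (A × B) (A × B) ℂ,
    IsSubState ρ' ∧ pDist ρ' ρ ≤ ε ∧ x = ImaxND ρ'}

/-- Smoothed max-information `I_max↓↓,ε(A:B)_ρ`. -/
def IddMaxEps (ε : ℝ) (ρ : Matrix (A × B) (A × B) ℂ) : EReal :=
  sInf {x : EReal | ∃ ρ' : Matrix (A × B) (A × B) ℂ,
    IsSubState ρ' ∧ pDist ρ' ρ ≤ ε ∧ x = IddMax ρ'}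

/-- Smoothed Rényi conditional entropy `H_α↑,ε(A|B)_ρ`. -/
def HUpEps (α ε : ℝ) (ρ : Matrix (A × B) (A × B) ℂ) : EReal :=
  sSup {x : EReal | ∃ ρ' : Matrix (A × B) (A × B) ℂ,
    IsSubState ρ' ∧ pDist ρ' ρ ≤ ε ∧ x = HUp α ρ'}

end Smooth

/-- Extension `id_R ⊗ Φ` of a linear map on matrices, with a spectator register on the left. -/
def lext {R A B : Type*} (Φ : Matrix A A ℂ →ₗ[ℂ] Matrix B B ℂ) :
    Matrix (R × A) (R × A) ℂ →ₗ[ℂ] Matrix (R × B) (R × B) ℂ where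
  toFun ρ := Matrix.of fun p q => Φ (Matrix.of fun a a' => ρ (p.1, a) (q.1, a')) p.2 q.2
  map_add' x y := by
    ext p q
    show Φ ((Matrix.of fun a a' => x (p.1, a) (q.1, a'))
        + (Matrix.of fun a a' => y (p.1, a) (q.1, a'))) p.2 q.2 = _
    rw [map_add]; rfl
  map_smul' c x := by
    ext p q
    show Φ (c • (Matrix.of fun a a' => x (p.1, a) (q.1, a'))) p.2 q.2 = _
    rw [_root_.map_smul]; rfl

/-- Extension `Φ ⊗ id_R` of a linear map on matrices, with a spectator register on the right. -/
def rext {A B R : Type*} (Φ : Matrix A A ℂ →ₗ[ℂ] Matrix B B ℂ) :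
    Matrix (A × R) (A × R) ℂ →ₗ[ℂ] Matrix (B × R) (B × R) ℂ where
  toFun ρ := Matrix.of fun p q => Φ (Matrix.of fun a a' => ρ (a, p.2) (a', q.2)) p.1 q.1
  map_add' x y := by
    ext p q
    show Φ ((Matrix.of fun a a' => x (a, p.2) (a', q.2))
        + (Matrix.of fun a a' => y (a, p.2) (a', q.2))) p.1 q.1 = _
    rw [map_add]; rfl
  map_smul' c x := by
    ext p q
    show Φ (c • (Matrix.of fun a a' => x (a, p.2) (a', q.2))) p.1 q.1 = _
    rw [_root_.map_smul]; rfl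

/-- Completely positive trace-preserving map (quantum channel). -/
structure IsCPTP {A B : Type*} [Fintype A] [Fintype B]
    (Φ : Matrix A A ℂ →ₗ[ℂ] Matrix B B ℂ) : Prop where
  cp : ∀ (n : ℕ) (ρ : Matrix (Fin n × A) (Fin n × A) ℂ), ρ.PosSemidef →
    ((lext Φ) ρ).PosSemidef
  tp : ∀ ρ : Matrix A A ℂ, (Φ ρ).trace = ρ.trace

/-- The rank-one (pure) state associated to a vector. -/
def pureState {A : Type*} (ψ : A → ℂ) : Matrix A A ℂ := Matrix.vecMulVec ψ (star ψ)


section MatrixPower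
set_option linter.unusedSectionVars false
variable [Fintype A] [DecidableEq A] [Fintype B] [DecidableEq B]

lemma aeval_unitary_conj {U : Matrix A A ℂ} (hU : U ∈ unitary (Matrix A A ℂ)) (d : A → ℂ)
    (q : Polynomial ℂ) :
    Polynomial.aeval (U * diagonal d * star U) q =
      U * diagonal (fun i => q.eval (d i)) * star U := by
  have h1 : star U * U = 1 := (Unitary.mem_iff.1 hU).1
  have h2 : U * star U = 1 := (Unitary.mem_iff.1 hU).2
  induction q using Polynomial.induction_on' with
  | add p q hp hq =>
    rw [map_add, hp, hq, ← add_mul, ← mul_add, diagonal_add]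
    simp
  | monomial n c =>
    have hpow : (U * diagonal d * star U) ^ n = U * diagonal (fun i => d i ^ n) * star U := by
      induction n with
      | zero => simp [h2]
      | succ n ih =>
        rw [pow_succ, ih]
        calc _ = U * diagonal (fun i => d i ^ n) * (star U * U) * diagonal d * star U := by
              simp only [mul_assoc]
          _ = U * (diagonal (fun i => d i ^ n) * diagonal d) * star U := by
              rw [h1, mul_one]; simp only [mul_assoc]
          _ = _ := by rw [diagonal_mul_diagonal]; simp only [pow_succ]
    have hd : diagonal (fun i => c * d i ^ n) = c • diagonal (fun i => d i ^ n) := by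
      rw [← diagonal_smul]; rfl
    simp [Polynomial.aeval_monomial, hpow, hd, Algebra.algebraMap_eq_smul_one]

lemma exists_polynomial_rpow (S : Finset ℝ) (p : ℝ) :
    ∃ q : Polynomial ℂ, ∀ x ∈ S, q.eval (x : ℂ) = ((x ^ p : ℝ) : ℂ) :=
  ⟨Lagrange.interpolate S (fun x : ℝ => (x : ℂ)) (fun x => ((x ^ p : ℝ) : ℂ)), fun _ hx =>
    Lagrange.eval_interpolate_at_node _ Complex.ofReal_injective.injOn hx⟩

lemma _root_.Matrix.IsHermitian.eq_unitary_conj {ρ : Matrix A A ℂ} (hρ : ρ.IsHermitian) :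
    ρ = (hρ.eigenvectorUnitary : Matrix A A ℂ) * diagonal (fun i => (hρ.eigenvalues i : ℂ)) *
      star (hρ.eigenvectorUnitary : Matrix A A ℂ) := by
  conv_lhs => rw [hρ.spectral_theorem]
  rfl

lemma mpow_eq_aeval {ρ : Matrix A A ℂ} (hρ : ρ.IsHermitian) {p : ℝ} {q : Polynomial ℂ}
    (h : ∀ i, q.eval (hρ.eigenvalues i : ℂ) = ((hρ.eigenvalues i ^ p : ℝ) : ℂ)) :
    mpow ρ p = Polynomial.aeval ρ q := by
  conv_rhs => rw [hρ.eq_unitary_conj]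
  rw [aeval_unitary_conj hρ.eigenvectorUnitary.2, mpow, dif_pos hρ]
  simp only [h]

lemma isHermitian_unitary_conj (U : Matrix A A ℂ) (d : A → ℝ) :
    (U * diagonal (fun i => (d i : ℂ)) * star U).IsHermitian := by
  simp only [IsHermitian, star_eq_conjTranspose, conjTranspose_mul, conjTranspose_conjTranspose,
    diagonal_conjTranspose, mul_assoc]
  congr 3
  ext i
  simp

lemma mpow_unitary_conj {U : Matrix A A ℂ} (hU : U ∈ unitary (Matrix A A ℂ)) (d : A → ℝ) (p : ℝ) :
    mpow (U * diagonal (fun i => (d i : ℂ)) * star U) p =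
      U * diagonal (fun i => ((d i ^ p : ℝ) : ℂ)) * star U := by
  have hH := isHermitian_unitary_conj U d
  obtain ⟨q, hq⟩ := exists_polynomial_rpow
    (Finset.univ.image hH.eigenvalues ∪ Finset.univ.image d) p
  rw [mpow_eq_aeval hH (q := q) (fun i => hq _ (by simp)), aeval_unitary_conj hU]
  congr 3
  ext i
  exact hq _ (by simp)

lemma _root_.Matrix.PosSemidef.exists_unitary_conj {ρ : Matrix A A ℂ} (hρ : ρ.PosSemidef) :
    ∃ U ∈ unitary (Matrix A A ℂ), ∃ d : A → ℝ, (∀ i, 0 ≤ d i) ∧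
      ρ = U * diagonal (fun i => (d i : ℂ)) * star U :=
  ⟨_, hρ.1.eigenvectorUnitary.2, _, hρ.eigenvalues_nonneg, hρ.1.eq_unitary_conj⟩

lemma posSemidef_mpow {ρ : Matrix A A ℂ} (hρ : ρ.PosSemidef) (p : ℝ) : (mpow ρ p).PosSemidef := by
  obtain ⟨U, hU, d, hd, rfl⟩ := hρ.exists_unitary_conj
  rw [mpow_unitary_conj hU]
  refine PosSemidef.mul_mul_conjTranspose_same (posSemidef_diagonal_iff.2 fun i => ?_) U
  exact_mod_cast Real.rpow_nonneg (hd i) p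

lemma mpow_one {ρ : Matrix A A ℂ} (hρ : ρ.PosSemidef) : mpow ρ 1 = ρ := by
  obtain ⟨U, hU, d, hd, rfl⟩ := hρ.exists_unitary_conj
  simp [mpow_unitary_conj hU]

lemma mpow_mpow {ρ : Matrix A A ℂ} (hρ : ρ.PosSemidef) (p q : ℝ) :
    mpow (mpow ρ p) q = mpow ρ (p * q) := by
  obtain ⟨U, hU, d, hd, rfl⟩ := hρ.exists_unitary_conj
  rw [mpow_unitary_conj hU, mpow_unitary_conj hU, mpow_unitary_conj hU]
  simp only [Real.rpow_mul (hd _)]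

lemma mpow_smul {ρ : Matrix A A ℂ} (hρ : ρ.PosSemidef) {c : ℝ} (hc : 0 ≤ c) (p : ℝ) :
    mpow ((c : ℂ) • ρ) p = ((c ^ p : ℝ) : ℂ) • mpow ρ p := by
  obtain ⟨U, hU, d, hd, rfl⟩ := hρ.exists_unitary_conj
  have key (c : ℝ) (d : A → ℝ) : (c : ℂ) • (U * diagonal (fun i => (d i : ℂ)) * star U) =
      U * diagonal (fun i => ((c * d i : ℝ) : ℂ)) * star U := by
    rw [← smul_mul_assoc, ← mul_smul_comm, ← diagonal_smul]
    congr 3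
    ext i
    simp
  rw [key, mpow_unitary_conj hU, mpow_unitary_conj hU, key]
  simp only [Real.mul_rpow hc (hd _)]

lemma mpow_one_matrix (p : ℝ) : mpow (1 : Matrix A A ℂ) p = 1 := by
  simpa using mpow_unitary_conj (one_mem (unitary (Matrix A A ℂ))) (fun _ : A => (1 : ℝ)) p

lemma unitary_conj_mul {U : Matrix A A ℂ} (hU : U ∈ unitary (Matrix A A ℂ)) (d e : A → ℂ) :
    U * diagonal d * star U * (U * diagonal e * star U) =
      U * diagonal (fun i => d i * e i) * star U := by
  calc _ = U * diagonal d * (star U * U) * diagonal e * star U := by simp only [mul_assoc]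
    _ = U * (diagonal d * diagonal e) * star U := by
      rw [(Unitary.mem_iff.1 hU).1, mul_one]; simp only [mul_assoc]
    _ = _ := by rw [diagonal_mul_diagonal]

lemma mpow_mul_mpow_mul_mpow {ρ : Matrix A A ℂ} (hρ : ρ.PosSemidef) {p q r : ℝ}
    (h : p + q + r ≠ 0) : mpow ρ p * mpow ρ q * mpow ρ r = mpow ρ (p + q + r) := by
  obtain ⟨U, hU, d, hd, rfl⟩ := hρ.exists_unitary_conj
  simp only [mpow_unitary_conj hU, unitary_conj_mul hU]
  congr 3
  ext i
  rw [← Complex.ofReal_mul, ← Complex.ofReal_mul]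
  congr 1
  rcases (hd i).eq_or_lt with h0 | h0
  · rw [← h0, Real.zero_rpow h]
    by_contra hne
    simp only [mul_eq_zero, not_or, Real.rpow_eq_zero_iff_of_nonneg le_rfl] at hne
    apply h
    simp_all
  · rw [Real.rpow_add h0, Real.rpow_add h0]

lemma mpow_mul_mpow {ρ : Matrix A A ℂ} (hρ : ρ.PosSemidef) {p q : ℝ}
    (h : p + q ≠ 0) : mpow ρ p * mpow ρ q = mpow ρ (p + q) := by
  obtain ⟨U, hU, d, hd, rfl⟩ := hρ.exists_unitary_conj
  simp only [mpow_unitary_conj hU, unitary_conj_mul hU]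
  congr 3
  ext i
  rw [← Complex.ofReal_mul, Real.rpow_add' (hd i) h]

lemma mpow_mul_comm {ρ : Matrix A A ℂ} (hρ : ρ.PosSemidef) (p q : ℝ) :
    mpow ρ p * mpow ρ q = mpow ρ q * mpow ρ p := by
  obtain ⟨U, hU, d, hd, rfl⟩ := hρ.exists_unitary_conj
  simp only [mpow_unitary_conj hU, unitary_conj_mul hU, mul_comm]

lemma mpow_kronecker {ρ : Matrix A A ℂ} {σ : Matrix B B ℂ} (hρ : ρ.PosSemidef)
    (hσ : σ.PosSemidef) (p : ℝ) : mpow (ρ ⊗ₖ σ) p = mpow ρ p ⊗ₖ mpow σ p := by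
  obtain ⟨U, hU, d, hd, rfl⟩ := hρ.exists_unitary_conj
  obtain ⟨V, hV, e, he, rfl⟩ := hσ.exists_unitary_conj
  have key (d : A → ℝ) (e : B → ℝ) :
      (U * diagonal (fun i => (d i : ℂ)) * star U) ⊗ₖ (V * diagonal (fun i => (e i : ℂ)) * star V) =
      (U ⊗ₖ V) * diagonal (fun i : A × B => ((d i.1 * e i.2 : ℝ) : ℂ)) * star (U ⊗ₖ V) := by
    rw [mul_kronecker_mul, mul_kronecker_mul, diagonal_kronecker_diagonal,
      star_eq_conjTranspose (U ⊗ₖ V), conjTranspose_kronecker]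
    simp [star_eq_conjTranspose]
  rw [key, mpow_unitary_conj (kronecker_mem_unitary hU hV), mpow_unitary_conj hU,
    mpow_unitary_conj hV, key]
  simp only [Real.mul_rpow (hd _) (he _)]

lemma trace_aeval_mul_comm (X Y : Matrix A A ℂ) {q : Polynomial ℂ} (hq : q.eval 0 = 0) :
    (Polynomial.aeval (X * Y) q).trace = (Polynomial.aeval (Y * X) q).trace := by
  obtain ⟨r, rfl⟩ : Polynomial.X ∣ q :=
    Polynomial.X_dvd_iff.2 (by rwa [Polynomial.coeff_zero_eq_eval_zero])
  clear hq
  have key : Y * Polynomial.aeval (X * Y) r = Polynomial.aeval (Y * X) r * Y := by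
    induction r using Polynomial.induction_on' with
    | add p q hp hq => rw [map_add, map_add, mul_add, add_mul, hp, hq]
    | monomial n c =>
      have h : Y * (X * Y) ^ n = (Y * X) ^ n * Y := by
        induction n with
        | zero => simp
        | succ n ih =>
          rw [pow_succ, pow_succ, ← mul_assoc, ih]; simp only [mul_assoc]
      simp [Polynomial.aeval_monomial, Algebra.algebraMap_eq_smul_one, h]
  simp only [map_mul, Polynomial.aeval_X]
  rw [mul_assoc, key, trace_mul_comm, mul_assoc, trace_mul_comm]

lemma trace_mpow_mul_conjTranspose (X : Matrix A A ℂ) {p : ℝ} (hp : p ≠ 0) :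
    (mpow (X * Xᴴ) p).trace = (mpow (Xᴴ * X) p).trace := by
  have h1 := isHermitian_mul_conjTranspose_self X
  have h2 := isHermitian_conjTranspose_mul_self X
  obtain ⟨q, hq⟩ := exists_polynomial_rpow
    ((Finset.univ.image h1.eigenvalues ∪ Finset.univ.image h2.eigenvalues) ∪ {0}) p
  rw [mpow_eq_aeval h1 (q := q) (fun i => hq _ (by simp)),
    mpow_eq_aeval h2 (q := q) (fun i => hq _ (by simp))]
  refine trace_aeval_mul_comm _ _ ?_
  simpa [Real.zero_rpow hp] using hq 0 (by simp)

lemma mpow_eq_zero_iff {ρ : Matrix A A ℂ} (hρ : ρ.PosSemidef) {p : ℝ} (hp : p ≠ 0) :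
    mpow ρ p = 0 ↔ ρ = 0 := by
  constructor
  · intro h
    rw [← mpow_one hρ, ← add_sub_cancel p 1, ← mpow_mul_mpow hρ (by simp), h, zero_mul]
  · rintro rfl
    have h := mpow_mul_mpow hρ (p := 1) (q := p - 1) (by simpa using hp)
    rw [mpow_one hρ, zero_mul] at h
    simpa using h.symm

lemma trace_eq_ofReal_re {ρ : Matrix A A ℂ} (hρ : ρ.PosSemidef) :
    ρ.trace = ((ρ.trace.re : ℝ) : ℂ) :=
  Complex.ext rfl (Complex.nonneg_iff.1 hρ.trace_nonneg).2.symm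

lemma trace_re_pos {ρ : Matrix A A ℂ} (hρ : ρ.PosSemidef) (h : ρ ≠ 0) : 0 < ρ.trace.re := by
  refine lt_of_le_of_ne (Complex.nonneg_iff.1 hρ.trace_nonneg).1 fun h0 => h ?_
  rw [← hρ.trace_eq_zero_iff, trace_eq_ofReal_re hρ, ← h0, Complex.ofReal_zero]

lemma mul_mpow_eq_zero_iff (X : Matrix A A ℂ) {τ : Matrix A A ℂ} (hτ : τ.PosSemidef)
    {s : ℝ} (hs : s ≠ 0) : X * mpow τ s = 0 ↔ X * τ = 0 := by
  constructor <;> intro h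
  · rw [← mpow_one hτ, ← add_sub_cancel s 1, ← mpow_mul_mpow hτ (by simp), ← mul_assoc, h, zero_mul]
  · rw [← add_sub_cancel 1 s, ← mpow_mul_mpow hτ (by simpa using hs), mpow_one hτ, ← mul_assoc, h,
      zero_mul]

lemma mpow_half_mul_self {ρ : Matrix A A ℂ} (hρ : ρ.PosSemidef) :
    mpow ρ (1 / 2) * mpow ρ (1 / 2) = ρ := by
  rw [mpow_mul_mpow hρ (by norm_num), add_halves, mpow_one hρ]

lemma trace_mpow_conj {ρ : Matrix A A ℂ} (hρ : ρ.PosSemidef) (K : Matrix A A ℂ) {p : ℝ}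
    (hp : p ≠ 0) : (mpow (K * ρ * Kᴴ) p).trace =
      (mpow (mpow ρ (1 / 2) * (Kᴴ * K) * mpow ρ (1 / 2)) p).trace := by
  have h := trace_mpow_mul_conjTranspose (K * mpow ρ (1 / 2)) hp
  rw [conjTranspose_mul, (posSemidef_mpow hρ _).1.eq] at h
  convert h using 3
  · rw [← mul_assoc, mul_assoc K (mpow ρ _), mpow_half_mul_self hρ]
  · simp only [mul_assoc]

lemma conj_mpow_eq_zero_iff {ρ τ : Matrix A A ℂ} (hρ : ρ.PosSemidef) (hτ : τ.PosSemidef)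
    {s : ℝ} (hs : s ≠ 0) : mpow τ s * ρ * mpow τ s = 0 ↔ ρ * τ = 0 := by
  have h : mpow τ s * ρ * mpow τ s =
      (mpow ρ (1 / 2) * mpow τ s)ᴴ * (mpow ρ (1 / 2) * mpow τ s) := by
    rw [conjTranspose_mul, (posSemidef_mpow hρ _).1.eq, (posSemidef_mpow hτ _).1.eq, mul_assoc,
      mul_assoc, ← mul_assoc (mpow ρ (1 / 2)), mpow_half_mul_self hρ]
  rw [h, conjTranspose_mul_self_eq_zero, mul_mpow_eq_zero_iff _ hτ hs]
  constructor <;> intro h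
  · rw [← mpow_half_mul_self hρ, mul_assoc, h, mul_zero]
  · have h' : mpow ρ (1 / 2) = mpow ρ (-(1 / 2)) * ρ := by
      conv_rhs => rw [← mpow_one hρ, mpow_mpow hρ, mpow_mul_mpow hρ (by norm_num)]
      norm_num
    rw [h', mul_assoc, h, mul_zero]

end MatrixPower

section PartialTrace
set_option linter.unusedSectionVars false
variable [Fintype A] [DecidableEq A] [Fintype B] [DecidableEq B]

lemma suppSubset_iff {ρ σ : Matrix A A ℂ} :
    suppSubset ρ σ ↔ ∀ X : Matrix A A ℂ, σ * X = 0 → ρ * X = 0 := by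
  constructor
  · intro h X hX
    ext i j
    have hcol : σ *ᵥ X.col j = 0 := by ext k; exact congr_fun₂ hX k j
    exact congr_fun (h _ hcol) i
  · intro h v hv
    have hX : σ * (of fun i _ : A => v i) = 0 := by ext k j; exact congr_fun hv k
    ext i
    exact congr_fun₂ (h _ hX) i i

/-- Orthogonal projection onto the kernel of a positive semidefinite matrix. -/
def kerProj (σ : Matrix A A ℂ) : Matrix A A ℂ := 1 - mpow σ (-1) * σ

lemma mul_kerProj {σ : Matrix A A ℂ} (hσ : σ.PosSemidef) : σ * kerProj σ = 0 := by
  have h := mpow_mul_mpow_mul_mpow hσ (p := 1) (q := -1) (r := 1) (by norm_num)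
  norm_num [mpow_one hσ] at h
  rw [kerProj, mul_sub, ← mul_assoc, h, mul_one, sub_self]

lemma kerProj_mul_of_mul_eq_zero {σ X : Matrix A A ℂ} (h : σ * X = 0) : kerProj σ * X = X := by
  rw [kerProj, sub_mul, one_mul, mul_assoc, h, mul_zero, sub_zero]

lemma posSemidef_kerProj {σ : Matrix A A ℂ} (hσ : σ.PosSemidef) : (kerProj σ).PosSemidef := by
  have hH : (kerProj σ)ᴴ = kerProj σ := by
    have h := mpow_mul_comm hσ 1 (-1)
    rw [mpow_one hσ] at h
    rw [kerProj, conjTranspose_sub, conjTranspose_one, conjTranspose_mul, hσ.1.eq,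
      (posSemidef_mpow hσ _).1.eq, h]
  have h := posSemidef_conjTranspose_mul_self (kerProj σ)
  rwa [hH, kerProj_mul_of_mul_eq_zero (mul_kerProj hσ)] at h

lemma posSemidef_ptB {ρ : Matrix (A × B) (A × B) ℂ} (hρ : ρ.PosSemidef) : (ptB ρ).PosSemidef := by
  have h : ptB ρ = ∑ b, ρ.submatrix (fun a => (a, b)) (fun a => (a, b)) := by
    ext a a'
    simp [ptB, Matrix.sum_apply]
  rw [h]
  exact posSemidef_sum _ fun b _ => hρ.submatrix _

lemma trace_ptB (ρ : Matrix (A × B) (A × B) ℂ) : (ptB ρ).trace = ρ.trace := by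
  simp [trace, ptB, Fintype.sum_prod_type]

lemma ptB_kronecker_one_mul (X : Matrix A A ℂ) (ρ : Matrix (A × B) (A × B) ℂ) :
    ptB ((X ⊗ₖ (1 : Matrix B B ℂ)) * ρ) = X * ptB ρ := by
  ext a a'
  simp only [ptB, of_apply, mul_apply, kroneckerMap_apply, Fintype.sum_prod_type, one_apply,
    mul_ite, mul_one, mul_zero, ite_mul, zero_mul, Finset.sum_ite_eq, Finset.mem_univ, if_true,
    Finset.mul_sum]
  exact Finset.sum_comm

lemma ptB_mul_kronecker_one (X : Matrix A A ℂ) (ρ : Matrix (A × B) (A × B) ℂ) :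
    ptB (ρ * (X ⊗ₖ (1 : Matrix B B ℂ))) = ptB ρ * X := by
  ext a a'
  simp only [ptB, of_apply, mul_apply, kroneckerMap_apply, Fintype.sum_prod_type, one_apply,
    mul_ite, mul_one, mul_zero, Finset.sum_ite_eq', Finset.mem_univ, if_true,
    Finset.sum_mul]
  exact Finset.sum_comm

lemma kronecker_mul_kronecker_one (X Z : Matrix A A ℂ) (Y : Matrix B B ℂ) :
    (X ⊗ₖ Y) * (Z ⊗ₖ (1 : Matrix B B ℂ)) = (X * Z) ⊗ₖ Y := by
  rw [← mul_kronecker_mul, mul_one]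

lemma kronecker_one_mul_kronecker (X Z : Matrix A A ℂ) (Y : Matrix B B ℂ) :
    (Z ⊗ₖ (1 : Matrix B B ℂ)) * (X ⊗ₖ Y) = (Z * X) ⊗ₖ Y := by
  rw [← mul_kronecker_mul, one_mul]

/-- Support projection of a positive semidefinite matrix. -/
def suppProj (ρ : Matrix A A ℂ) : Matrix A A ℂ := mpow ρ (-(1 / 2)) * mpow ρ (1 / 2)

lemma suppProj_comm {ρ : Matrix A A ℂ} (hρ : ρ.PosSemidef) :
    mpow ρ (1 / 2) * mpow ρ (-(1 / 2)) = suppProj ρ := mpow_mul_comm hρ _ _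

lemma conjTranspose_suppProj {ρ : Matrix A A ℂ} (hρ : ρ.PosSemidef) :
    (suppProj ρ)ᴴ = suppProj ρ := by
  rw [suppProj, conjTranspose_mul, (posSemidef_mpow hρ _).1.eq, (posSemidef_mpow hρ _).1.eq,
    suppProj_comm hρ, suppProj]

lemma mpow_half_mul_suppProj {ρ : Matrix A A ℂ} (hρ : ρ.PosSemidef) :
    mpow ρ (1 / 2) * suppProj ρ = mpow ρ (1 / 2) := by
  rw [suppProj, ← mul_assoc, mpow_mul_mpow_mul_mpow hρ (by norm_num)]
  norm_num

lemma mul_suppProj {ρ : Matrix A A ℂ} (hρ : ρ.PosSemidef) : ρ * suppProj ρ = ρ := by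
  nth_rw 1 [← mpow_half_mul_self hρ]
  rw [mul_assoc, mpow_half_mul_suppProj hρ, mpow_half_mul_self hρ]

lemma mul_eq_zero_of_conj_eq_zero {ρ Y : Matrix A A ℂ} (hρ : ρ.PosSemidef)
    (h : Yᴴ * ρ * Y = 0) : mpow ρ (1 / 2) * Y = 0 := by
  rw [← conjTranspose_mul_self_eq_zero, conjTranspose_mul, (posSemidef_mpow hρ _).1.eq,
    mul_assoc, ← mul_assoc (mpow ρ _), mpow_half_mul_self hρ, ← mul_assoc, h]

lemma mpow_half_mul_suppProj_ptB {ρ : Matrix (A × B) (A × B) ℂ} (hρ : ρ.PosSemidef) :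
    mpow ρ (1 / 2) * (suppProj (ptB ρ) ⊗ₖ (1 : Matrix B B ℂ)) = mpow ρ (1 / 2) := by
  have hR := posSemidef_ptB hρ
  set Y := (1 - suppProj (ptB ρ)) ⊗ₖ (1 : Matrix B B ℂ) with hY
  have hY0 : Yᴴ * ρ * Y = 0 := by
    rw [← (hρ.conjTranspose_mul_mul_same Y).trace_eq_zero_iff, ← trace_ptB]
    rw [hY, ptB_mul_kronecker_one, conjTranspose_kronecker, conjTranspose_one,
      ptB_kronecker_one_mul, mul_assoc, mul_sub, mul_one, mul_suppProj hR, sub_self, mul_zero,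
      trace_zero]
  have h := mul_eq_zero_of_conj_eq_zero hρ hY0
  have hsub : Y = 1 - suppProj (ptB ρ) ⊗ₖ (1 : Matrix B B ℂ) := by
    rw [hY, eq_sub_iff_add_eq, ← add_kronecker, sub_add_cancel, one_kronecker_one]
  rw [hsub, mul_sub, mul_one, sub_eq_zero] at h
  exact h.symm

end PartialTrace

section TiltedState
set_option linter.unusedSectionVars false
variable [Fintype A] [DecidableEq A] [Fintype B] [DecidableEq B]

/-- The operator `R^{1/2} ω^{(1−α)/α} R^{1/2}`. -/
def tiltedOp (α : ℝ) (R ω : Matrix A A ℂ) : Matrix A A ℂ :=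
  mpow R (1 / 2 : ℝ) * mpow ω ((1 - α) / α) * mpow R (1 / 2 : ℝ)

/-- The normalized power `M^α / Tr[M^α]`. -/
def normPow (α : ℝ) (M : Matrix A A ℂ) : Matrix A A ℂ := (mpow M α).trace⁻¹ • mpow M α

/-- The state `η^{1/2} ρ_{B|A} η^{1/2}`. -/
def reweight (ρ : Matrix (A × B) (A × B) ℂ) (η : Matrix A A ℂ) : Matrix (A × B) (A × B) ℂ :=
  (mpow η (1 / 2 : ℝ) ⊗ₖ (1 : Matrix B B ℂ)) *
    ((mpow (ptB ρ) (-(1 / 2) : ℝ) ⊗ₖ (1 : Matrix B B ℂ)) * ρ *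
      (mpow (ptB ρ) (-(1 / 2) : ℝ) ⊗ₖ (1 : Matrix B B ℂ))) *
    (mpow η (1 / 2 : ℝ) ⊗ₖ (1 : Matrix B B ℂ))

lemma tiltedOp_one {R : Matrix A A ℂ} (hR : R.PosSemidef) (α : ℝ) : tiltedOp α R 1 = R := by
  rw [tiltedOp, mpow_one_matrix, mul_one, mpow_half_mul_self hR]

lemma posSemidef_tiltedOp {R ω : Matrix A A ℂ} (hR : R.PosSemidef) (hω : ω.PosSemidef) (α : ℝ) :
    (tiltedOp α R ω).PosSemidef := by
  have h := (posSemidef_mpow hω ((1 - α) / α)).mul_mul_conjTranspose_same (mpow R (1 / 2))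
  rwa [(posSemidef_mpow hR _).1.eq] at h

lemma tiltedOp_mul_suppProj {R : Matrix A A ℂ} (hR : R.PosSemidef) (ω : Matrix A A ℂ) (α : ℝ) :
    tiltedOp α R ω * suppProj R = tiltedOp α R ω := by
  rw [tiltedOp, mul_assoc, mpow_half_mul_suppProj hR]

lemma conj_tiltedOp {R : Matrix A A ℂ} (hR : R.PosSemidef) (ω : Matrix A A ℂ) (α : ℝ) :
    mpow R (-(1 / 2)) * tiltedOp α R ω * mpow R (-(1 / 2)) =
      suppProj R * mpow ω ((1 - α) / α) * suppProj R := by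
  conv_rhs => rw [← suppProj_comm hR]
  rw [tiltedOp, suppProj_comm hR]
  nth_rw 2 [← suppProj_comm hR]
  rw [suppProj]
  simp only [mul_assoc]

lemma normPow_eq {M : Matrix A A ℂ} (hM : M.PosSemidef) (α : ℝ) :
    normPow α M = (((mpow M α).trace.re⁻¹ : ℝ) : ℂ) • mpow M α := by
  rw [normPow, trace_eq_ofReal_re (posSemidef_mpow hM α), Complex.ofReal_inv, Complex.ofReal_re]

lemma posSemidef_normPow {M : Matrix A A ℂ} (hM : M.PosSemidef) (α : ℝ) :
    (normPow α M).PosSemidef := by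
  have h := posSemidef_mpow hM α
  rw [normPow_eq hM]
  refine h.smul ?_
  exact_mod_cast inv_nonneg.2 (Complex.nonneg_iff.1 h.trace_nonneg).1

lemma trace_normPow {M : Matrix A A ℂ} (hM : M.PosSemidef) (hM0 : M ≠ 0) {α : ℝ} (hα : α ≠ 0) :
    (normPow α M).trace = 1 := by
  have h : (mpow M α).trace ≠ 0 := by
    rwa [Ne, (posSemidef_mpow hM α).trace_eq_zero_iff, mpow_eq_zero_iff hM hα]
  rw [normPow, trace_smul, smul_eq_mul, inv_mul_cancel₀ h]

lemma mpow_normPow {M : Matrix A A ℂ} (hM : M.PosSemidef) (α p : ℝ) :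
    mpow (normPow α M) p = (((mpow M α).trace.re⁻¹ ^ p : ℝ) : ℂ) • mpow M (α * p) := by
  have h := posSemidef_mpow hM α
  rw [normPow_eq hM, mpow_smul h (inv_nonneg.2 (Complex.nonneg_iff.1 h.trace_nonneg).1),
    mpow_mpow hM]

lemma mpow_normPow_half_mul {M P : Matrix A A ℂ} (hM : M.PosSemidef) {α : ℝ} (hα : α ≠ 0)
    (hP : M * P = M) : mpow (normPow α M) (1 / 2) * P = mpow (normPow α M) (1 / 2) := by
  have h : mpow M (α * (1 / 2)) = mpow M (α * (1 / 2) - 1) * M := by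
    conv_rhs => rw [← mpow_one hM, mpow_mpow hM, mpow_mul_mpow hM (by simpa using hα)]
    simp
  rw [mpow_normPow hM, smul_mul_assoc, h, mul_assoc, hP]

lemma reweight_eq (ρ : Matrix (A × B) (A × B) ℂ) (hρ : ρ.PosSemidef) {η : Matrix A A ℂ}
    (hη : η.PosSemidef) :
    reweight ρ η = ((mpow η (1 / 2) * mpow (ptB ρ) (-(1 / 2))) ⊗ₖ (1 : Matrix B B ℂ)) * ρ *
      ((mpow η (1 / 2) * mpow (ptB ρ) (-(1 / 2))) ⊗ₖ (1 : Matrix B B ℂ))ᴴ := by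
  rw [conjTranspose_kronecker, conjTranspose_mul, (posSemidef_mpow hη _).1.eq,
    (posSemidef_mpow (posSemidef_ptB hρ) _).1.eq, conjTranspose_one, reweight,
    ← kronecker_mul_kronecker_one, ← kronecker_mul_kronecker_one]
  simp only [mul_assoc]

lemma posSemidef_reweight {ρ : Matrix (A × B) (A × B) ℂ} (hρ : ρ.PosSemidef) {η : Matrix A A ℂ}
    (hη : η.PosSemidef) : (reweight ρ η).PosSemidef := by
  rw [reweight_eq ρ hρ hη]
  exact hρ.mul_mul_conjTranspose_same _

lemma ptB_reweight {ρ : Matrix (A × B) (A × B) ℂ} (hρ : ρ.PosSemidef) {η : Matrix A A ℂ}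
    (hη : η.PosSemidef)
    (hP : mpow η (1 / 2) * suppProj (ptB ρ) = mpow η (1 / 2)) : ptB (reweight ρ η) = η := by
  have hR := posSemidef_ptB hρ
  rw [reweight, ptB_mul_kronecker_one, ptB_kronecker_one_mul, ptB_mul_kronecker_one,
    ptB_kronecker_one_mul]
  have h : mpow (ptB ρ) (-(1 / 2)) * ptB ρ * mpow (ptB ρ) (-(1 / 2)) =
      suppProj (ptB ρ) * suppProj (ptB ρ) := by
    nth_rw 2 [← mpow_half_mul_self hR]
    nth_rw 2 [← suppProj_comm hR]
    rw [suppProj]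
    simp only [mul_assoc]
  rw [h, ← mul_assoc, hP, hP, mpow_half_mul_self hη]

lemma suppSubset_reweight {ρ : Matrix (A × B) (A × B) ℂ} {ω η : Matrix A A ℂ} {σ : Matrix B B ℂ}
    (hη : η.PosSemidef) (h : suppSubset ρ (ω ⊗ₖ σ)) : suppSubset (reweight ρ η) (η ⊗ₖ σ) := by
  rw [suppSubset_iff] at h ⊢
  intro X hX
  have hη' : mpow η (1 / 2) = mpow η (-(1 / 2)) * η := by
    conv_rhs => rw [← mpow_one hη, mpow_mpow hη, mpow_mul_mpow hη (by norm_num)]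
    norm_num
  have h' := h ((mpow (ptB ρ) (-(1 / 2)) * mpow η (1 / 2)) ⊗ₖ (1 : Matrix B B ℂ) * X) (by
    rw [← mul_assoc, kronecker_mul_kronecker_one, hη', ← mul_assoc, ← mul_assoc,
      ← kronecker_one_mul_kronecker, mul_assoc, hX, mul_zero])
  rw [← kronecker_mul_kronecker_one] at h'
  rw [reweight]
  simp only [mul_assoc] at h' ⊢
  rw [h', mul_zero, mul_zero]

lemma suppSubset_ptB {ρ : Matrix (A × B) (A × B) ℂ} {ω : Matrix A A ℂ} {σ : Matrix B B ℂ}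
    (h : suppSubset ρ (ω ⊗ₖ σ)) : suppSubset (ptB ρ) ω := by
  rw [suppSubset_iff] at h ⊢
  intro X hX
  have h' := h (X ⊗ₖ (1 : Matrix B B ℂ)) (by
    rw [kronecker_mul_kronecker_one, hX, zero_kronecker])
  rw [← ptB_mul_kronecker_one, h']
  ext
  simp [ptB]

lemma mul_ne_zero_of_suppSubset {ρ τ : Matrix A A ℂ} (hρ : ρ.PosSemidef) (hτ : τ.PosSemidef)
    (hρ0 : ρ ≠ 0) (h : suppSubset ρ τ) : ρ * τ ≠ 0 := by
  intro h0
  have h1 : τ * ρ = 0 := by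
    rw [← hρ.1.eq, ← hτ.1.eq, ← conjTranspose_mul, h0, conjTranspose_zero]
  have h2 := suppSubset_iff.1 h ρ h1
  nth_rw 1 [← hρ.1.eq] at h2
  exact hρ0 (conjTranspose_mul_self_eq_zero.1 h2)

variable {α : ℝ}

lemma posSemidef_sandwich {ρ τ : Matrix A A ℂ} (hρ : ρ.PosSemidef) (hτ : τ.PosSemidef) (s : ℝ) :
    (mpow τ s * ρ * mpow τ s).PosSemidef := by
  have h := hρ.mul_mul_conjTranspose_same (mpow τ s)
  rwa [(posSemidef_mpow hτ _).1.eq] at h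

lemma trace_sandwich {ρ τ : Matrix A A ℂ} (hρ : ρ.PosSemidef) (hτ : τ.PosSemidef)
    (h0 : α ≠ 0) (h1 : α ≠ 1) :
    (mpow (mpow τ ((1 - α) / (2 * α)) * ρ * mpow τ ((1 - α) / (2 * α))) α).trace =
      (mpow (tiltedOp α ρ τ) α).trace := by
  have h := trace_mpow_conj hρ (mpow τ ((1 - α) / (2 * α))) h0
  have hs : (1 - α) / (2 * α) + (1 - α) / (2 * α) = (1 - α) / α := by field_simp; ring
  rwa [(posSemidef_mpow hτ _).1.eq, mpow_mul_mpow hτ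
    (by rw [hs]; exact div_ne_zero (sub_ne_zero.2 h1.symm) h0), hs] at h

lemma trace_sandwich_re_eq_zero_iff {ρ τ : Matrix A A ℂ} (hρ : ρ.PosSemidef) (hτ : τ.PosSemidef)
    (h0 : α ≠ 0) (h1 : α ≠ 1) :
    (mpow (mpow τ ((1 - α) / (2 * α)) * ρ * mpow τ ((1 - α) / (2 * α))) α).trace.re = 0 ↔
      ρ * τ = 0 := by
  have hQ := posSemidef_sandwich hρ hτ ((1 - α) / (2 * α))
  have hQ' := posSemidef_mpow hQ α
  rw [← Complex.ofReal_eq_zero, ← trace_eq_ofReal_re hQ', hQ'.trace_eq_zero_iff,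
    mpow_eq_zero_iff hQ h0, conj_mpow_eq_zero_iff hρ hτ
      (div_ne_zero (sub_ne_zero.2 h1.symm) (mul_ne_zero two_ne_zero h0))]

/-- The marginal tilted operator determines the bipartite one. -/
lemma tiltedOp_kronecker {ρ : Matrix (A × B) (A × B) ℂ} (hρ : ρ.PosSemidef)
    {ω : Matrix A A ℂ} (hω : ω.PosSemidef) {σ : Matrix B B ℂ} (hσ : σ.PosSemidef) :
    mpow ρ (1 / 2) * ((mpow (ptB ρ) (-(1 / 2)) * tiltedOp α (ptB ρ) ω * mpow (ptB ρ) (-(1 / 2))) ⊗ₖ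
      mpow σ ((1 - α) / α)) * mpow ρ (1 / 2) = tiltedOp α ρ (ω ⊗ₖ σ) := by
  have hP := mpow_half_mul_suppProj_ptB hρ
  have hP' := congrArg conjTranspose hP
  rw [conjTranspose_mul, (posSemidef_mpow hρ _).1.eq, conjTranspose_kronecker, conjTranspose_one,
    conjTranspose_suppProj (posSemidef_ptB hρ)] at hP'
  rw [conj_tiltedOp (posSemidef_ptB hρ), ← kronecker_mul_kronecker_one,
    ← kronecker_one_mul_kronecker, ← mul_assoc, ← mul_assoc, hP, mul_assoc, hP', tiltedOp,
    mpow_kronecker hω hσ]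

lemma tiltedOp_ptB_ne_zero {ρ : Matrix (A × B) (A × B) ℂ} (hρ : ρ.PosSemidef)
    {ω : Matrix A A ℂ} (hω : ω.PosSemidef) {σ : Matrix B B ℂ} (hσ : σ.PosSemidef)
    (h0 : α ≠ 0) (h1 : α ≠ 1) (h : ρ * (ω ⊗ₖ σ) ≠ 0) : tiltedOp α (ptB ρ) ω ≠ 0 := by
  intro hM
  refine h ((trace_sandwich_re_eq_zero_iff hρ (hω.kronecker hσ) h0 h1).1 ?_)
  rw [trace_sandwich hρ (hω.kronecker hσ) h0 h1, ← tiltedOp_kronecker hρ hω hσ, hM, mul_zero,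
    zero_mul, zero_kronecker, mul_zero, zero_mul, (mpow_eq_zero_iff PosSemidef.zero h0).2 rfl]
  simp

lemma trace_sandwich_reweight {ρ : Matrix (A × B) (A × B) ℂ} (hρ : ρ.PosSemidef)
    {ω : Matrix A A ℂ} (hω : ω.PosSemidef) {σ : Matrix B B ℂ} (hσ : σ.PosSemidef)
    (h0 : 0 < α) (h1 : α ≠ 1) {M η : Matrix A A ℂ} (hM : M = tiltedOp α (ptB ρ) ω)
    (hη : η = normPow α M) :
    (mpow (mpow (η ⊗ₖ σ) ((1 - α) / (2 * α)) * reweight ρ η *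
      mpow (η ⊗ₖ σ) ((1 - α) / (2 * α))) α).trace.re =
    (mpow M α).trace.re⁻¹ * (mpow (mpow (ω ⊗ₖ σ) ((1 - α) / (2 * α)) * ρ *
      mpow (ω ⊗ₖ σ) ((1 - α) / (2 * α))) α).trace.re := by
  have hR := posSemidef_ptB hρ
  have hMp : M.PosSemidef := hM ▸ posSemidef_tiltedOp hR hω α
  have hηp : η.PosSemidef := hη ▸ posSemidef_normPow hMp α
  have ht : 0 ≤ (mpow M α).trace.re⁻¹ :=
    inv_nonneg.2 (Complex.nonneg_iff.1 (posSemidef_mpow hMp α).trace_nonneg).1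
  set s := (1 - α) / (2 * α) with hs
  have hs2 : s + s = (1 - α) / α := by rw [hs]; field_simp; ring
  have hs3 : s + 1 / 2 = 1 / (2 * α) := by rw [hs]; field_simp; ring
  have hs4 : α * (1 / (2 * α)) = 1 / 2 := by field_simp
  set c := (mpow M α).trace.re⁻¹ ^ (1 / (2 * α)) with hc
  have hc0 : 0 ≤ c := Real.rpow_nonneg ht _
  have hcα : (c * c) ^ α = (mpow M α).trace.re⁻¹ := by
    rw [hc, ← Real.rpow_add_of_nonneg ht (by positivity) (by positivity), ← Real.rpow_mul ht]
    convert Real.rpow_one _ using 2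
    field_simp
    norm_num
  have hK : mpow (η ⊗ₖ σ) s * ((mpow η (1 / 2) * mpow (ptB ρ) (-(1 / 2))) ⊗ₖ (1 : Matrix B B ℂ)) =
      (c : ℂ) • ((mpow M (1 / 2) * mpow (ptB ρ) (-(1 / 2))) ⊗ₖ mpow σ s) := by
    rw [mpow_kronecker hηp hσ, kronecker_mul_kronecker_one, ← mul_assoc,
      mpow_mul_mpow hηp (by rw [hs3]; positivity), hs3, hη, mpow_normPow hMp, hs4, smul_mul_assoc,
      smul_kronecker]
  set K := mpow (η ⊗ₖ σ) s * ((mpow η (1 / 2) * mpow (ptB ρ) (-(1 / 2))) ⊗ₖ (1 : Matrix B B ℂ))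
    with hKdef
  have hQ : mpow (η ⊗ₖ σ) s * reweight ρ η * mpow (η ⊗ₖ σ) s = K * ρ * Kᴴ := by
    rw [reweight_eq ρ hρ hηp, hKdef, conjTranspose_mul (mpow _ _),
      (posSemidef_mpow (hηp.kronecker hσ) s).1.eq]
    simp only [mul_assoc]
  have hKK : Kᴴ * K = ((c * c : ℝ) : ℂ) •
      ((mpow (ptB ρ) (-(1 / 2)) * M * mpow (ptB ρ) (-(1 / 2))) ⊗ₖ mpow σ ((1 - α) / α)) := by
    rw [hK, conjTranspose_smul, conjTranspose_kronecker, conjTranspose_mul,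
      (posSemidef_mpow hMp _).1.eq, (posSemidef_mpow hR _).1.eq, (posSemidef_mpow hσ _).1.eq,
      smul_mul_smul_comm, ← mul_kronecker_mul, mpow_mul_mpow hσ
        (by rw [hs2]; exact div_ne_zero (sub_ne_zero.2 h1.symm) h0.ne'), hs2]
    congr 2
    · simp
    · rw [mul_assoc, ← mul_assoc (mpow M _), mpow_half_mul_self hMp, mul_assoc]
  rw [hQ, trace_mpow_conj hρ K h0.ne', hKK, mul_smul_comm, smul_mul_assoc, hM,
    tiltedOp_kronecker hρ hω hσ, mpow_smul (posSemidef_tiltedOp hρ (hω.kronecker hσ) α)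
      (mul_nonneg hc0 hc0), hcα, trace_sandwich hρ (hω.kronecker hσ) h0.ne' h1, trace_smul,
    smul_eq_mul, Complex.re_ofReal_mul, hM]

lemma DR_chain {ρ : Matrix (A × B) (A × B) ℂ} (hρ : IsState ρ)
    {ω : Matrix A A ℂ} (hω : ω.PosSemidef) {σ : Matrix B B ℂ} (hσ : σ.PosSemidef)
    (h0 : 0 < α) (h1 : α ≠ 1) (h : ρ * (ω ⊗ₖ σ) ≠ 0) {η : Matrix A A ℂ}
    (hη : η = normPow α (tiltedOp α (ptB ρ) ω)) :
    DR α ρ (ω ⊗ₖ σ) = DR α (ptB ρ) ω + DR α (reweight ρ η) (η ⊗ₖ σ) := by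
  have hR := posSemidef_ptB hρ.1
  have hMp := posSemidef_tiltedOp hR hω α
  have hM0 := tiltedOp_ptB_ne_zero hρ.1 hω hσ h0.ne' h1 h
  have hηp : η.PosSemidef := hη ▸ posSemidef_normPow hMp α
  have htr : (reweight ρ η).trace = 1 := by
    rw [← trace_ptB, ptB_reweight hρ.1 hηp (hη ▸ mpow_normPow_half_mul hMp h0.ne'
      (tiltedOp_mul_suppProj hR ω α)), hη, trace_normPow hMp hM0 h0.ne']
  have ht := trace_re_pos (posSemidef_mpow hMp α) ((mpow_eq_zero_iff hMp h0.ne').not.2 hM0)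
  have hq := (trace_sandwich_re_eq_zero_iff hρ.1 (hω.kronecker hσ) h0.ne' h1).not.2 h
  rw [DR, DR, DR, trace_sandwich_reweight hρ.1 hω hσ h0 h1 rfl hη, htr, trace_ptB, hρ.2,
    trace_sandwich hR hω h0.ne' h1]
  simp only [Complex.one_re, div_one]
  rw [Real.logb_mul (inv_ne_zero ht.ne') hq, Real.logb_inv]
  ring

lemma reweight_mul_kronecker_eq_zero_iff {ρ : Matrix (A × B) (A × B) ℂ} (hρ : ρ.PosSemidef)
    {ω : Matrix A A ℂ} (hω : ω.PosSemidef) {σ : Matrix B B ℂ} (hσ : σ.PosSemidef)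
    (h0 : 0 < α) (h1 : α ≠ 1) (hM0 : tiltedOp α (ptB ρ) ω ≠ 0) {η : Matrix A A ℂ}
    (hη : η = normPow α (tiltedOp α (ptB ρ) ω)) :
    reweight ρ η * (η ⊗ₖ σ) = 0 ↔ ρ * (ω ⊗ₖ σ) = 0 := by
  have hMp := posSemidef_tiltedOp (posSemidef_ptB hρ) hω α
  have hηp : η.PosSemidef := hη ▸ posSemidef_normPow hMp α
  have ht := trace_re_pos (posSemidef_mpow hMp α) ((mpow_eq_zero_iff hMp h0.ne').not.2 hM0)
  rw [← trace_sandwich_re_eq_zero_iff hρ (hω.kronecker hσ) h0.ne' h1,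
    ← trace_sandwich_re_eq_zero_iff (posSemidef_reweight hρ hηp) (hηp.kronecker hσ) h0.ne' h1,
    trace_sandwich_reweight hρ hω hσ h0 h1 rfl hη, mul_eq_zero]
  simp [ht.ne']

lemma suppSubset_of_reweight {ρ : Matrix (A × B) (A × B) ℂ} (hρ : ρ.PosSemidef) (hρ0 : ptB ρ ≠ 0)
    {σ : Matrix B B ℂ} (hσ : σ.PosSemidef) (h0 : 0 < α) (h1 : α ≠ 1) {η : Matrix A A ℂ}
    (hη : η = normPow α (ptB ρ)) (h : suppSubset (reweight ρ η) (η ⊗ₖ σ)) :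
    suppSubset ρ ((1 : Matrix A A ℂ) ⊗ₖ σ) := by
  have hT := tiltedOp_one (posSemidef_ptB hρ) α
  have hN : reweight ρ η * ((1 : Matrix A A ℂ) ⊗ₖ kerProj σ) = 0 :=
    suppSubset_iff.1 h _ (by rw [← mul_kronecker_mul, mul_kerProj hσ, kronecker_zero])
  have hN' : reweight ρ η * (η ⊗ₖ kerProj σ) = 0 := by
    have hk := kronecker_mul_kronecker_one (1 : Matrix A A ℂ) η (kerProj σ)
    rw [one_mul] at hk
    rw [← hk, ← mul_assoc, hN, zero_mul]
  rw [reweight_mul_kronecker_eq_zero_iff hρ PosSemidef.one (posSemidef_kerProj hσ) h0 h1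
    (by rwa [hT]) (by rwa [hT])] at hN'
  rw [suppSubset_iff]
  intro X hX
  have hX' : ((1 : Matrix A A ℂ) ⊗ₖ kerProj σ) * X = X := by
    have hk : (1 : Matrix A A ℂ) ⊗ₖ kerProj σ = 1 - ((1 : Matrix A A ℂ) ⊗ₖ mpow σ (-1)) *
        ((1 : Matrix A A ℂ) ⊗ₖ σ) := by
      rw [← mul_kronecker_mul, mul_one, eq_sub_iff_add_eq, ← kronecker_add, kerProj,
        sub_add_cancel, one_kronecker_one]
    rw [hk, sub_mul, one_mul, mul_assoc, hX, mul_zero, sub_zero]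
  rw [← hX', ← mul_assoc, hN', zero_mul]

lemma mul_eq_zero_and_iff {ρ τ : Matrix A A ℂ} (hρ : ρ.PosSemidef) (hτ : τ.PosSemidef) :
    (ρ * τ = 0 ∧ τ * ρ = 0) ↔ ρ * τ = 0 := by
  refine ⟨And.left, fun h => ⟨h, ?_⟩⟩
  rw [← hρ.1.eq, ← hτ.1.eq, ← conjTranspose_mul, h, conjTranspose_zero]

lemma IsState.ne_zero {ρ : Matrix A A ℂ} (hρ : IsState ρ) : ρ ≠ 0 := by
  rintro rfl
  simpa using hρ.2

lemma IsState.ptB {ρ : Matrix (A × B) (A × B) ℂ} (hρ : IsState ρ) : IsState (ptB ρ) :=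
  ⟨posSemidef_ptB hρ.1, by rw [trace_ptB, hρ.2]⟩

lemma D_eq_of_suppSubset {ρ σ : Matrix A A ℂ} (h : suppSubset ρ σ) :
    D α ρ σ = ((DR α ρ σ : ℝ) : EReal) := if_pos (Or.inr h)

lemma D_eq_coe {ρ τ : Matrix A A ℂ} (hρ : ρ.PosSemidef) (hτ : τ.PosSemidef)
    (h : (α < 1 ∧ ρ * τ ≠ 0) ∨ suppSubset ρ τ) : D α ρ τ = ((DR α ρ τ : ℝ) : EReal) :=
  if_pos (by rwa [mul_eq_zero_and_iff hρ hτ])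

lemma D_eq_top {ρ τ : Matrix A A ℂ} (hρ : ρ.PosSemidef) (hτ : τ.PosSemidef)
    (h : ¬((α < 1 ∧ ρ * τ ≠ 0) ∨ suppSubset ρ τ)) : D α ρ τ = ⊤ :=
  if_neg (by rwa [mul_eq_zero_and_iff hρ hτ])

lemma D_chain_one {ρ : Matrix (A × B) (A × B) ℂ} (hρ : IsState ρ) {σ : Matrix B B ℂ}
    (hσ : σ.PosSemidef) (h0 : 0 < α) (h1 : α ≠ 1) {η : Matrix A A ℂ}
    (hη : η = normPow α (ptB ρ)) :
    D α ρ ((1 : Matrix A A ℂ) ⊗ₖ σ) =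
      ((DR α (ptB ρ) 1 : ℝ) : EReal) + D α (reweight ρ η) (η ⊗ₖ σ) := by
  have hR := posSemidef_ptB hρ.1
  have hT := tiltedOp_one hR α
  have hηp : η.PosSemidef := hη ▸ posSemidef_normPow hR α
  have hτ : ((1 : Matrix A A ℂ) ⊗ₖ σ).PosSemidef := PosSemidef.one.kronecker hσ
  have hsupp : suppSubset (reweight ρ η) (η ⊗ₖ σ) ↔ suppSubset ρ ((1 : Matrix A A ℂ) ⊗ₖ σ) :=
    ⟨suppSubset_of_reweight hρ.1 hρ.ptB.ne_zero hσ h0 h1 hη, suppSubset_reweight hηp⟩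
  have hη' : η = normPow α (tiltedOp α (ptB ρ) 1) := by rwa [hT]
  have horth := reweight_mul_kronecker_eq_zero_iff hρ.1 PosSemidef.one hσ h0 h1
    (by rw [hT]; exact hρ.ptB.ne_zero) hη'
  have hcond : (α < 1 ∧ reweight ρ η * (η ⊗ₖ σ) ≠ 0) ∨ suppSubset (reweight ρ η) (η ⊗ₖ σ) ↔
      (α < 1 ∧ ρ * ((1 : Matrix A A ℂ) ⊗ₖ σ) ≠ 0) ∨ suppSubset ρ ((1 : Matrix A A ℂ) ⊗ₖ σ) := by
    rw [hsupp, Ne, horth]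
  have hρη := posSemidef_reweight hρ.1 hηp
  have hησ := hηp.kronecker hσ
  by_cases hif : (α < 1 ∧ ρ * ((1 : Matrix A A ℂ) ⊗ₖ σ) ≠ 0) ∨
      suppSubset ρ ((1 : Matrix A A ℂ) ⊗ₖ σ)
  · have hne : ρ * ((1 : Matrix A A ℂ) ⊗ₖ σ) ≠ 0 :=
      hif.elim And.right (mul_ne_zero_of_suppSubset hρ.1 hτ hρ.ne_zero)
    rw [D_eq_coe hρ.1 hτ hif, D_eq_coe hρη hησ (hcond.2 hif),
      DR_chain hρ PosSemidef.one hσ h0 h1 hne hη', EReal.coe_add]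
  · rw [D_eq_top hρ.1 hτ hif, D_eq_top hρη hησ (hcond.not.2 hif), EReal.coe_add_top]

lemma _root_.EReal.sInf_coe_add {ι : Type*} (p : ι → Prop) (c : ℝ) (f : ι → EReal) :
    sInf {x : EReal | ∃ i, p i ∧ x = c + f i} = c + sInf {x : EReal | ∃ i, p i ∧ x = f i} := by
  have hc {a b : EReal} : a - c ≤ b ↔ a ≤ c + b := by
    rw [EReal.sub_le_iff_le_add (.inl (EReal.coe_ne_bot c)) (.inl (EReal.coe_ne_top c)), add_comm]
  apply le_antisymm
  · rw [← hc]
    refine le_sInf ?_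
    rintro _ ⟨i, hi, rfl⟩
    rw [hc]
    exact sInf_le ⟨i, hi, rfl⟩
  · refine le_sInf ?_
    rintro _ ⟨i, hi, rfl⟩
    gcongr
    exact sInf_le ⟨i, hi, rfl⟩

end TiltedState

/-! ## Statement 9
Exact chain-rule identity `D_α(ρ_AB‖ω_A⊗σ_B) = D_α(ρ_A‖ω_A) + D_α(η_AB‖η_A⊗σ_B)`,
and the particular case `H_α↑(A|B)_ρ = H_α(A)_ρ − I_α↓(A;B)_η`. -/

theorem renyi_divergence_exact_chain
    {A B : Type*} [Fintype A] [DecidableEq A] [Fintype B] [DecidableEq B]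
    (ρ : Matrix (A × B) (A × B) ℂ) (hρ : IsState ρ)
    (ω : Matrix A A ℂ) (hω : ω.PosSemidef)
    (σ : Matrix B B ℂ) (hσ : σ.PosSemidef)
    (α : ℝ) (hα : α ∈ Set.Ioo (0 : ℝ) 1 ∪ Set.Ioi (1 : ℝ))
    (hsupp : suppSubset ρ (ω ⊗ₖ σ))
    -- the conditional operator `ρ_{B|A}` (pseudoinverse square roots)
    (condBA : Matrix (A × B) (A × B) ℂ)
    (hcond : condBA = ((mpow (ptB ρ) (-(1 / 2) : ℝ)) ⊗ₖ (1 : Matrix B B ℂ)) * ρ *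
      ((mpow (ptB ρ) (-(1 / 2) : ℝ)) ⊗ₖ (1 : Matrix B B ℂ)))
    -- `η_A = (ρ_A^{1/2} ω^{(1−α)/α} ρ_A^{1/2})^α / Tr[…]` and `η_AB = η_A^{1/2} ρ_{B|A} η_A^{1/2}`
    (ηA : Matrix A A ℂ)
    (hηA : ηA =
      ((mpow (mpow (ptB ρ) (1 / 2 : ℝ) * mpow ω ((1 - α) / α) * mpow (ptB ρ) (1 / 2 : ℝ)) α).trace)⁻¹
        • mpow (mpow (ptB ρ) (1 / 2 : ℝ) * mpow ω ((1 - α) / α) * mpow (ptB ρ) (1 / 2 : ℝ)) α)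
    (ηAB : Matrix (A × B) (A × B) ℂ)
    (hηAB : ηAB = ((mpow ηA (1 / 2 : ℝ)) ⊗ₖ (1 : Matrix B B ℂ)) * condBA *
      ((mpow ηA (1 / 2 : ℝ)) ⊗ₖ (1 : Matrix B B ℂ)))
    -- the particular case `ω_A = 𝟙_A`, where `η_A = ρ_A^α / Tr[ρ_A^α]`
    (ηA' : Matrix A A ℂ)
    (hηA' : ηA' = ((mpow (ptB ρ) α).trace)⁻¹ • mpow (ptB ρ) α)
    (ηAB' : Matrix (A × B) (A × B) ℂ)
    (hηAB' : ηAB' = ((mpow ηA' (1 / 2 : ℝ)) ⊗ₖ (1 : Matrix B B ℂ)) * condBA *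
      ((mpow ηA' (1 / 2 : ℝ)) ⊗ₖ (1 : Matrix B B ℂ))) :
    D α ρ (ω ⊗ₖ σ) = D α (ptB ρ) ω + D α ηAB (ηA ⊗ₖ σ) ∧
    HUp α ρ = (- D α (ptB ρ) (1 : Matrix A A ℂ)) - Idown α ηAB' := by
  have h0 : 0 < α := hα.elim (fun h => h.1) (fun h => one_pos.trans h)
  have h1 : α ≠ 1 := hα.elim (fun h => h.2.ne) (fun h => ne_of_gt h)
  have hR := posSemidef_ptB hρ.1
  constructor
  · obtain rfl : ηA = normPow α (tiltedOp α (ptB ρ) ω) := hηA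
    obtain rfl : ηAB = reweight ρ (normPow α (tiltedOp α (ptB ρ) ω)) := by rw [hηAB, hcond]; rfl
    rw [D_eq_of_suppSubset hsupp, D_eq_of_suppSubset (suppSubset_ptB hsupp),
      D_eq_of_suppSubset (suppSubset_reweight
        (posSemidef_normPow (posSemidef_tiltedOp hR hω α) α) hsupp), ← EReal.coe_add,
      DR_chain hρ hω hσ h0 h1
        (mul_ne_zero_of_suppSubset hρ.1 (hω.kronecker hσ) hρ.ne_zero hsupp) rfl]
  · obtain rfl : ηA' = normPow α (ptB ρ) := hηA'
    obtain rfl : ηAB' = reweight ρ (normPow α (ptB ρ)) := by rw [hηAB', hcond]; rfl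
    have hpt : ptB (reweight ρ (normPow α (ptB ρ))) = normPow α (ptB ρ) :=
      ptB_reweight hρ.1 (posSemidef_normPow hR α)
        (mpow_normPow_half_mul hR h0.ne' (mul_suppProj hR))
    have hone : suppSubset (ptB ρ) 1 := suppSubset_iff.2 fun X hX => by
      rw [← one_mul X, hX, mul_zero]
    have hset : {x : EReal | ∃ σ : Matrix B B ℂ, IsState σ ∧
          x = D α ρ ((1 : Matrix A A ℂ) ⊗ₖ σ)} =
        {x : EReal | ∃ σ : Matrix B B ℂ, IsState σ ∧ x = ((DR α (ptB ρ) 1 : ℝ) : EReal) +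
          D α (reweight ρ (normPow α (ptB ρ))) (normPow α (ptB ρ) ⊗ₖ σ)} := by
      ext x
      exact exists_congr fun σ => and_congr_right fun hσ => by
        rw [D_chain_one hρ hσ.1 h0 h1 rfl]
    rw [HUp, Idown, hpt, hset, EReal.sInf_coe_add, D_eq_of_suppSubset hone,
      EReal.neg_add (.inl (EReal.coe_ne_bot _)) (.inl (EReal.coe_ne_top _))]

end QITLeak
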